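/- There exist unique polynomials K_{i,j} ∈ ℂ[x], indexed by pairs (i,j) with 0 ≤ i ≤ n, 0 ≤ j ≤ r−1 and ir+j ≤ N, such that det Wr(φ_1, …, φ_N, u)(x) = Σ_{i,j} K_{i,j}(x)·(d/dx)^j(L₀^i u)(x) for every entire function u and every x ∈ ℂ. Moreover deg K_{i,0} ≤ n for all i, deg K_{i,j} ≤ n−1 whenever j ≥ 1, and K_{n,0} has degree exactly n with leading coefficient equal to V^r or −V^r. Consequently the operator F defined on entire functions u by (Fu)(x) := Σ_{i,j} x^i·(d/dx)^j(K_{i,j}(L₀)u)(x) (the ♭-transform of the Wronskian operator, where K_{i,j}(L₀) is the polynomial K_{i,j} evaluated at the operator L₀) is an ordinary differential operator of order exactly N = rn. -/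

import Mathlib

open scoped BigOperators

/-- The generalized Airy operator `L₀ u = u^(r) - ∑_{k=1}^{r-2} a_k u^(k) - x·u`. -/
noncomputable def airyOp (r : ℕ) (a : ℕ → ℂ) (u : ℂ → ℂ) : ℂ → ℂ :=
  fun x => iteratedDeriv r u x
    - (∑ k ∈ Finset.Ico 1 (r - 1), a k * iteratedDeriv k u x) - x * u x

/-- The Wronskian determinant of an `m`-tuple of functions. -/
noncomputable def wrDet (m : ℕ) (g : Fin m → ℂ → ℂ) (x : ℂ) : ℂ :=
  Matrix.det (Matrix.of fun k s : Fin m => iteratedDeriv k.val (g s) x)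

/-- The bordered Wronskian determinant `det Wr(g₁, …, g_m, u)`. -/
noncomputable def wrDetB (m : ℕ) (g : Fin m → ℂ → ℂ) (u : ℂ → ℂ) (x : ℂ) : ℂ :=
  wrDet (m + 1) (Fin.snoc g u) x

/-- The family `φ_{i,j}(x) = γ_i·f_j(x+λ_i) + f_j'(x+λ_i)`, listed in a fixed order
as `φ_1, …, φ_N` with `N = r·n` (index `k` corresponds to `i = k / r`, `j = k % r`). -/
noncomputable def phiFam (r n : ℕ) (f : ℕ → ℂ → ℂ) (lam gam : ℕ → ℂ) :
    Fin (r * n) → ℂ → ℂ :=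
  fun k x => gam (k.val / r) * f (k.val % r) (x + lam (k.val / r)) +
    deriv (f (k.val % r)) (x + lam (k.val / r))

/-- The Vandermonde-type product `V = ∏_{i<j} (λ_i - λ_j)`. -/
noncomputable def vand (n : ℕ) (lam : ℕ → ℂ) : ℂ :=
  ∏ i ∈ Finset.range n, ∏ j ∈ Finset.Ico (i + 1) n, (lam i - lam j)

/-- The polynomial `p` evaluated at the operator `L₀`. -/
noncomputable def polyOpAiry (r : ℕ) (a : ℕ → ℂ) (p : Polynomial ℂ) (u : ℂ → ℂ) : ℂ → ℂ :=
  fun x => ∑ k ∈ Finset.range (p.natDegree + 1), p.coeff k * (airyOp r a)^[k] u x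

/-- The index set of pairs `(i,j)` with `i ≤ n`, `j ≤ r-1` and `i·r + j ≤ N = r·n`. -/
def idxSet (r n : ℕ) : Finset (ℕ × ℕ) :=
  (Finset.range (n + 1) ×ˢ Finset.range r).filter fun q => q.1 * r + q.2 ≤ r * n

/-- `K` is the (unique) family of polynomial coefficients expressing the Wronskian
operator `u ↦ det Wr(φ₁, …, φ_N, u)` as `∑ K_{i,j}(x)·(d/dx)^j (L₀^i u)(x)`. -/
def ExpProp (r n : ℕ) (a : ℕ → ℂ) (φ : Fin (r * n) → ℂ → ℂ)
    (K : ℕ → ℕ → Polynomial ℂ) : Prop :=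
  (∀ i j : ℕ, (i, j) ∉ idxSet r n → K i j = 0) ∧
  ∀ u : ℂ → ℂ, Differentiable ℂ u → ∀ x : ℂ,
    wrDetB (r * n) φ u x =
      ∑ q ∈ idxSet r n, (K q.1 q.2).eval x * iteratedDeriv q.2 ((airyOp r a)^[q.1] u) x

/-- The ♭-transformed operator `F u = ∑_{i,j} x^i·(d/dx)^j (K_{i,j}(L₀) u)`. -/
noncomputable def Fop (r n : ℕ) (a : ℕ → ℂ) (K : ℕ → ℕ → Polynomial ℂ)
    (u : ℂ → ℂ) : ℂ → ℂ :=
  fun x => ∑ q ∈ idxSet r n, x ^ q.1 * iteratedDeriv q.2 (polyOpAiry r a (K q.1 q.2) u) x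

/-- `T` acts on entire functions as a linear differential operator of order at most `m` with
polynomial coefficients, the coefficient of the `m`-th derivative being `c`. -/
def IsDiffOp (T : (ℂ → ℂ) → ℂ → ℂ) (m : ℕ) (c : Polynomial ℂ) : Prop :=
  ∃ C : ℕ → Polynomial ℂ, C m = c ∧ ∀ u : ℂ → ℂ, Differentiable ℂ u → ∀ x : ℂ,
    T u x = ∑ k ∈ Finset.range (m + 1), (C k).eval x * iteratedDeriv k u x

theorem differentiable_iteratedDeriv_of_entire {u : ℂ → ℂ} (hu : Differentiable ℂ u) (k : ℕ) :
    Differentiable ℂ (iteratedDeriv k u) :=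
  (hu.contDiff (n := ⊤)).differentiable_iteratedDeriv k (by exact_mod_cast WithTop.coe_lt_top _)

namespace IsDiffOp

variable {T S : (ℂ → ℂ) → ℂ → ℂ} {m : ℕ} {c d : Polynomial ℂ}

theorem congr (hT : IsDiffOp T m c)
    (h : ∀ u : ℂ → ℂ, Differentiable ℂ u → ∀ x, S u x = T u x) : IsDiffOp S m c := by
  obtain ⟨C, hC, hT⟩ := hT
  exact ⟨C, hC, fun u hu x => (h u hu x).trans (hT u hu x)⟩

theorem zero (m : ℕ) : IsDiffOp (fun _ _ => 0) m 0 := ⟨0, rfl, by simp⟩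

theorem id : IsDiffOp (fun u => u) 0 1 := ⟨1, rfl, by simp⟩

theorem raise (hT : IsDiffOp T m c) {k : ℕ} (hk : m < k) : IsDiffOp T k 0 := by
  obtain ⟨C, -, hT⟩ := hT
  refine ⟨fun l => if l ∈ Finset.range (m + 1) then C l else 0, by simp; omega, fun u hu x => ?_⟩
  rw [hT u hu x]
  refine Finset.sum_subset_zero_on_sdiff (Finset.range_mono (by omega)) (fun l hl => ?_)
    (fun l hl => by simp only [if_pos hl])
  simp only [if_neg (Finset.mem_sdiff.1 hl).2, Polynomial.eval_zero, zero_mul]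

theorem add (hT : IsDiffOp T m c) (hS : IsDiffOp S m d) :
    IsDiffOp (fun u x => T u x + S u x) m (c + d) := by
  obtain ⟨C, hC, hT⟩ := hT
  obtain ⟨D, hD, hS⟩ := hS
  refine ⟨fun k => C k + D k, by simp [hC, hD], fun u hu x => ?_⟩
  simp only [hT u hu x, hS u hu x, Polynomial.eval_add, add_mul, Finset.sum_add_distrib]

theorem mul (p : Polynomial ℂ) (hT : IsDiffOp T m c) :
    IsDiffOp (fun u x => p.eval x * T u x) m (p * c) := by
  obtain ⟨C, hC, hT⟩ := hT
  refine ⟨fun k => p * C k, by simp [hC], fun u hu x => ?_⟩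
  simp only [hT u hu x, Polynomial.eval_mul, Finset.mul_sum, mul_assoc]

theorem sum {ι : Type*} (s : Finset ι) {T : ι → (ℂ → ℂ) → ℂ → ℂ} {c : ι → Polynomial ℂ}
    (h : ∀ i ∈ s, IsDiffOp (T i) m (c i)) :
    IsDiffOp (fun u x => ∑ i ∈ s, T i u x) m (∑ i ∈ s, c i) := by
  classical
  induction s using Finset.induction_on with
  | empty => simpa using zero m
  | insert a s ha ih =>
    simp only [Finset.sum_insert ha]
    exact (h a (by simp)).add (ih fun i hi => h i (by simp [hi]))

theorem deriv (hT : IsDiffOp T m c) : IsDiffOp (fun u => deriv (T u)) (m + 1) c := by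
  obtain ⟨C, hC, hT⟩ := hT
  refine (show IsDiffOp (fun u x => (∑ k ∈ Finset.range (m + 1),
      (Polynomial.derivative (C k)).eval x * iteratedDeriv k u x) +
      ∑ k ∈ Finset.range (m + 1), (C k).eval x * iteratedDeriv (k + 1) u x) (m + 1) c from ?_).congr
    fun u hu x => ?_
  · rw [← zero_add c]
    refine (raise ⟨fun k => Polynomial.derivative (C k), rfl, fun u hu x => rfl⟩
      (Nat.lt_succ_self m)).add ⟨fun k => if k = 0 then 0 else C (k - 1), by simp [hC],
        fun u hu x => ?_⟩
    rw [Finset.sum_range_succ' _ (m + 1)]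
    simp
  · rw [funext (hT u hu), ← Finset.sum_add_distrib]
    refine HasDerivAt.deriv (HasDerivAt.fun_sum fun k _ => ?_)
    refine ((C k).hasDerivAt x).mul ?_
    rw [iteratedDeriv_succ]
    exact (differentiable_iteratedDeriv_of_entire hu k x).hasDerivAt

theorem iteratedDeriv (hT : IsDiffOp T m c) (j : ℕ) :
    IsDiffOp (fun u => iteratedDeriv j (T u)) (m + j) c := by
  induction j with
  | zero => simpa using hT
  | succ j ih => simpa only [iteratedDeriv_succ, ← add_assoc] using ih.deriv

theorem airyOp (hT : IsDiffOp T m c) {r : ℕ} (hr : 0 < r) (a : ℕ → ℂ) :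
    IsDiffOp (fun u => airyOp r a (T u)) (m + r) c := by
  have h₁ := IsDiffOp.sum (m := m + r) (Finset.Ico 1 (r - 1))
    (T := fun k u x => (Polynomial.C (-a k)).eval x * _root_.iteratedDeriv k (T u) x)
    (c := fun k => Polynomial.C (-a k) * 0)
    fun k hk => ((hT.iteratedDeriv k).raise (by simp at hk; omega)).mul _
  have h₂ := (hT.raise (show m < m + r by omega)).mul (-Polynomial.X)
  have h := ((hT.iteratedDeriv r).add h₁).add h₂
  simp only [mul_zero, Finset.sum_const_zero, add_zero] at h
  refine h.congr fun u hu x => ?_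
  simp only [_root_.airyOp, Polynomial.eval_C, Polynomial.eval_neg, Polynomial.eval_X, neg_mul,
    Finset.sum_neg_distrib]
  ring

theorem differentiable (hT : IsDiffOp T m c) {u : ℂ → ℂ} (hu : Differentiable ℂ u) :
    Differentiable ℂ (T u) := by
  obtain ⟨C, -, hT⟩ := hT
  rw [funext (hT u hu)]
  exact Differentiable.fun_sum fun k _ =>
    (C k).differentiable.mul (differentiable_iteratedDeriv_of_entire hu k)

end IsDiffOp

theorem isDiffOp_airyOp_iterate {r : ℕ} (hr : 0 < r) (a : ℕ → ℂ) (i : ℕ) :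
    IsDiffOp (fun u => (airyOp r a)^[i] u) (i * r) 1 := by
  induction i with
  | zero => simpa using IsDiffOp.id
  | succ i ih => simpa only [Function.iterate_succ_apply', Nat.succ_mul] using ih.airyOp hr a

theorem isDiffOp_iteratedDeriv_airyOp_iterate {r : ℕ} (hr : 0 < r) (a : ℕ → ℂ) (k : ℕ) :
    IsDiffOp (fun u => iteratedDeriv (k % r) ((airyOp r a)^[k / r] u)) k 1 := by
  simpa only [Nat.div_add_mod'] using (isDiffOp_airyOp_iterate hr a (k / r)).iteratedDeriv (k % r)

theorem isDiffOp_polyOpAiry {r : ℕ} (hr : 0 < r) (a : ℕ → ℂ) {p : Polynomial ℂ} {n : ℕ}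
    (hp : p.natDegree ≤ n) :
    IsDiffOp (polyOpAiry r a p) (n * r) (Polynomial.C (p.coeff n)) := by
  have h := IsDiffOp.sum (m := n * r) (Finset.range (p.natDegree + 1))
    (T := fun k u x => (Polynomial.C (p.coeff k)).eval x * (airyOp r a)^[k] u x)
    (c := fun k => Polynomial.C (p.coeff k) * if k = n then 1 else 0) fun k hk => by
      refine IsDiffOp.mul _ ?_
      split_ifs with hkn
      · exact hkn ▸ isDiffOp_airyOp_iterate hr a k
      · refine (isDiffOp_airyOp_iterate hr a k).raise (Nat.mul_lt_mul_of_pos_right ?_ hr)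
        simp at hk
        omega
  simp only [Polynomial.eval_C, mul_ite, mul_one, mul_zero, Finset.sum_ite_eq'] at h
  convert h using 1
  · rfl
  split_ifs with hn
  · rfl
  · rw [Polynomial.coeff_eq_zero_of_natDegree_lt (by simpa using hn), map_zero]

theorem isDiffOp_Fop {r n : ℕ} (hr : 0 < r) (a : ℕ → ℂ) {K : ℕ → ℕ → Polynomial ℂ}
    (h₀ : ∀ i, (K i 0).natDegree ≤ n) (h₁ : ∀ i j, 1 ≤ j → (K i j).degree < n) :
    ∃ c : Polynomial ℂ, c.coeff n = (K n 0).coeff n ∧ IsDiffOp (Fop r n a K) (r * n) c := by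
  have h := IsDiffOp.sum (m := r * n) (idxSet r n)
    (T := fun q u x => (Polynomial.X ^ q.1 : Polynomial ℂ).eval x *
      iteratedDeriv q.2 (polyOpAiry r a (K q.1 q.2) u) x)
    (c := fun q => Polynomial.X ^ q.1 *
      if q.2 = 0 then Polynomial.C ((K q.1 0).coeff n) else 0) fun q hq => by
      refine IsDiffOp.mul _ ?_
      split_ifs with hq0
      · simpa only [hq0, add_zero, mul_comm n r] using
          (isDiffOp_polyOpAiry hr a (h₀ q.1)).iteratedDeriv 0
      · by_cases hK : K q.1 q.2 = 0
        · refine (IsDiffOp.zero _).congr fun u hu x => ?_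
          have : polyOpAiry r a (K q.1 q.2) u = fun _ => 0 := by
            funext y; simp [polyOpAiry, hK]
          rw [this]
          simp
        have hlt := (Polynomial.natDegree_lt_iff_degree_lt hK).2 (h₁ q.1 q.2 (by omega))
        have hn : n = (n - 1) + 1 := by omega
        refine ((isDiffOp_polyOpAiry hr a (n := n - 1) (by omega)).iteratedDeriv q.2).raise ?_
        have : q.2 < r := by simp [idxSet] at hq; omega
        rw [mul_comm r n]
        conv_rhs => rw [hn, Nat.succ_mul]
        omega
  simp only [Polynomial.eval_pow, Polynomial.eval_X] at h
  refine ⟨_, ?_, h⟩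
  rw [Polynomial.finsetSum_coeff, Finset.sum_eq_single (n, 0)]
  · simp
  · rintro ⟨i, j⟩ - hij
    by_cases hj : j = 0
    · have : n ≠ i := by rintro rfl; simp [hj] at hij
      simp only [hj, if_true, Polynomial.coeff_mul_C, Polynomial.coeff_X_pow, if_neg this,
        zero_mul]
    · simp [hj]
  · intro hn
    simp [idxSet, hr, mul_comm] at hn

theorem det_isDiffOp_rows {T : ℕ → (ℂ → ℂ) → ℂ → ℂ} (hT : ∀ k, IsDiffOp (T k) k 1) {m : ℕ}
    {h : Fin m → ℂ → ℂ} (hh : ∀ s, Differentiable ℂ (h s)) (x : ℂ) :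
    Matrix.det (Matrix.of fun k s : Fin m => T k (h s) x) = wrDet m h x := by
  choose C hC hT using hT
  let U : Matrix (Fin m) (Fin m) ℂ := Matrix.of fun k l =>
    if l ∈ Finset.univ.filter (fun l : Fin m => l.val ∈ Finset.range (k.val + 1))
    then (C k l).eval x else 0
  have hU : U.det = 1 := by
    rw [Matrix.det_of_isLowerTriangular U fun k l hkl => by
      have : k < l := hkl
      simp [U, this.not_ge]]
    refine Finset.prod_eq_one fun k _ => ?_
    simp [U, hC]
  have hUW : (Matrix.of fun k s : Fin m => T k (h s) x) =
      U * Matrix.of fun k s : Fin m => iteratedDeriv k.val (h s) x := by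
    ext k s
    simp only [Matrix.of_apply, Matrix.mul_apply, U, ite_mul, zero_mul, hT k (h s) (hh s) x]
    rw [Finset.sum_ite_mem, Finset.univ_inter]
    symm
    refine Finset.sum_bij (fun l _ => l.val) (fun l hl => by simpa using hl)
      (fun l _ l' _ hl => Fin.ext hl) (fun l hl => ?_) (fun l _ => rfl)
    have := Finset.mem_range.1 hl
    exact ⟨⟨l, by omega⟩, by simp only [Finset.mem_filter, Finset.mem_univ, true_and]; exact hl,
      rfl⟩
  rw [hUW, Matrix.det_mul, hU, one_mul, wrDet]

theorem eq_zero_of_sum_isDiffOp_eq_zero {T : ℕ → (ℂ → ℂ) → ℂ → ℂ}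
    (hT : ∀ k, IsDiffOp (T k) k 1) {m : ℕ} {κ : Fin m → ℂ} {x : ℂ}
    (h : ∀ u : ℂ → ℂ, Differentiable ℂ u → ∑ k : Fin m, κ k * T k u x = 0) : κ = 0 := by
  let g : Fin m → ℂ → ℂ := fun s z => Complex.exp ((s : ℂ) * z)
  have hg : ∀ s, Differentiable ℂ (g s) := fun s => by fun_prop
  refine Matrix.eq_zero_of_vecMul_eq_zero
    (M := Matrix.of fun k s : Fin m => T k (g s) x) ?_ ?_
  · rw [det_isDiffOp_rows hT hg, wrDet]
    have : (Matrix.of fun k s : Fin m => iteratedDeriv k.val (g s) x) = Matrix.of fun k s : Fin m =>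
        Complex.exp ((s : ℂ) * x) * (Matrix.vandermonde fun s : Fin m => (s : ℂ)).transpose k s := by
      ext k s
      simp only [g, iteratedDeriv_cexp_const_mul, Matrix.vandermonde_apply, Matrix.of_apply,
        Matrix.transpose_apply]
      ring
    rw [this, Matrix.det_mul_row, Matrix.det_transpose]
    refine mul_ne_zero (Finset.prod_ne_zero_iff.2 fun s _ => Complex.exp_ne_zero _)
      (Matrix.det_vandermonde_ne_zero_iff.2 fun s t hst => ?_)
    exact Fin.ext (by exact_mod_cast hst)
  · ext s
    simpa [Matrix.vecMul, dotProduct] using h (g s) (hg s)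

theorem mem_idxSet {r n i j : ℕ} : (i, j) ∈ idxSet r n ↔ i ≤ n ∧ j < r ∧ i * r + j ≤ r * n := by
  simp [idxSet, and_assoc]

theorem div_mod_mem_idxSet {r n : ℕ} (hr : 0 < r) (k : Fin (r * n + 1)) :
    (k.val / r, k.val % r) ∈ idxSet r n := by
  have hk := k.isLt
  rw [mem_idxSet, Nat.div_add_mod', ← Nat.lt_succ_iff, Nat.div_lt_iff_lt_mul hr, Nat.succ_mul,
    mul_comm n r]
  exact ⟨by omega, Nat.mod_lt _ hr, by omega⟩

theorem sum_idxSet {r n : ℕ} (hr : 0 < r) (F : ℕ → ℕ → ℂ) :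
    ∑ q ∈ idxSet r n, F q.1 q.2 = ∑ k : Fin (r * n + 1), F (k.val / r) (k.val % r) := by
  symm
  refine Finset.sum_bij (fun k _ => (k.val / r, k.val % r))
    (fun k _ => div_mod_mem_idxSet hr k) (fun k _ l _ h => ?_) (fun q hq => ?_) (fun k _ => rfl)
  · simp only [Prod.mk.injEq] at h
    refine Fin.ext ?_
    rw [← Nat.div_add_mod' k.val r, ← Nat.div_add_mod' l.val r, h.1, h.2]
  · simp only [idxSet, Finset.mem_filter, Finset.mem_product, Finset.mem_range] at hq
    refine ⟨⟨q.1 * r + q.2, by omega⟩, Finset.mem_univ _, Prod.ext ?_ ?_⟩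
    · simp [mul_comm q.1 r, Nat.mul_add_div hr, Nat.div_eq_of_lt hq.1.2]
    · simp [mul_comm q.1 r, Nat.mod_eq_of_lt hq.1.2]

theorem Matrix.det_fromCols_replicateCol {R I : Type*} [CommRing R] [Fintype I] [DecidableEq I]
    (M : Matrix (I ⊕ Fin 1) I R) (b : I ⊕ Fin 1 → R) :
    (fromCols M (replicateCol (Fin 1) b)).det =
      ∑ q, b q * (fromCols M (replicateCol (Fin 1) (Pi.single q 1))).det := by
  have h : ∀ b : I ⊕ Fin 1 → R, (fromCols M (replicateCol (Fin 1) b)).det =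
      cramer (fromCols M 0) b (Sum.inr 0) := fun b => by
    rw [cramer_apply]
    congr 1
    ext q (p | p)
    · simp
    · simp [Subsingleton.elim p 0]
  simp only [h, cramer_eq_adjugate_mulVec, mulVec_single_one]
  simp [mulVec, dotProduct, mul_comm]

theorem Matrix.det_fromCols_mul_replicateCol {R I : Type*} [CommRing R] [Fintype I] [DecidableEq I]
    (M : Matrix (I ⊕ Fin 1) I R) (W : Matrix I I R) (b : I ⊕ Fin 1 → R) :
    (fromCols (M * W) (replicateCol (Fin 1) b)).det =
      (fromCols M (replicateCol (Fin 1) b)).det * W.det := by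
  have h : fromCols (M * W) (replicateCol (Fin 1) b) =
      fromCols M (replicateCol (Fin 1) b) * fromBlocks W 0 0 1 := by
    rw [fromCols_mul_fromBlocks]; simp
  rw [h, det_mul, det_fromBlocks_zero₁₂, det_one, mul_one]

theorem Polynomial.coeff_prod_sum_of_natDegree_le {R ι : Type*} [CommRing R] (s : Finset ι)
    (p : ι → Polynomial R) (d : ι → ℕ) (h : ∀ i ∈ s, (p i).natDegree ≤ d i) :
    (∏ i ∈ s, p i).coeff (∑ i ∈ s, d i) = ∏ i ∈ s, (p i).coeff (d i) := by
  classical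
  induction s using Finset.induction_on with
  | empty => simp
  | insert a s ha ih =>
    have hs : ∀ i ∈ s, (p i).natDegree ≤ d i := fun i hi => h i (by simp [hi])
    rw [Finset.prod_insert ha, Finset.prod_insert ha, Finset.sum_insert ha,
      Polynomial.coeff_mul_add_eq_of_natDegree_le (h a (by simp))
        ((Polynomial.natDegree_prod_le _ _).trans (Finset.sum_le_sum hs)), ih hs]

theorem Matrix.natDegree_det_le_sum {R ι : Type*} [CommRing R] [Fintype ι] [DecidableEq ι]
    {M : Matrix ι ι (Polynomial R)} {d : ι → ℕ} (h : ∀ i j, (M i j).natDegree ≤ d i) :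
    M.det.natDegree ≤ ∑ i, d i := by
  rw [det_apply]
  refine Polynomial.natDegree_sum_le_of_forall_le _ _ fun σ _ => ?_
  refine (Polynomial.natDegree_smul_le _ _).trans ((Polynomial.natDegree_prod_le _ _).trans ?_)
  exact (Finset.sum_le_sum fun i _ => h (σ i) i).trans (Equiv.sum_comp σ d).le

theorem Matrix.coeff_det_sum {R ι : Type*} [CommRing R] [Fintype ι] [DecidableEq ι]
    {M : Matrix ι ι (Polynomial R)} {d : ι → ℕ} (h : ∀ i j, (M i j).natDegree ≤ d i) :
    M.det.coeff (∑ i, d i) = (of fun i j => (M i j).coeff (d i)).det := by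
  rw [det_apply, det_apply, Polynomial.finsetSum_coeff]
  refine Finset.sum_congr rfl fun σ _ => ?_
  rw [Polynomial.coeff_smul, ← Equiv.sum_comp σ d,
    Polynomial.coeff_prod_sum_of_natDegree_le _ _ _ fun i _ => h (σ i) i]
  rfl

theorem iteratedDeriv_linearCombination (c d : ℂ) {u v : ℂ → ℂ}
    (hu : Differentiable ℂ u) (hv : Differentiable ℂ v) (k : ℕ) (x : ℂ) :
    iteratedDeriv k (fun x => c * u x + d * v x) x =
      c * iteratedDeriv k u x + d * iteratedDeriv k v x := by
  have hu' : ContDiff ℂ k (fun x => c * u x) := (hu.const_mul c).contDiff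
  have hv' : ContDiff ℂ k (fun x => d * v x) := (hv.const_mul d).contDiff
  rw [iteratedDeriv_fun_add hu'.contDiffAt hv'.contDiffAt, iteratedDeriv_const_mul_field,
    iteratedDeriv_const_mul_field]

theorem airyOp_linearCombination (r : ℕ) (a : ℕ → ℂ) (c d : ℂ) {u v : ℂ → ℂ}
    (hu : Differentiable ℂ u) (hv : Differentiable ℂ v) :
    airyOp r a (fun x => c * u x + d * v x) =
      fun x => c * airyOp r a u x + d * airyOp r a v x := by
  funext x
  simp only [airyOp, iteratedDeriv_linearCombination c d hu hv, mul_sub, mul_add, Finset.mul_sum,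
    Finset.sum_add_distrib, mul_left_comm]
  ring

theorem airyOp_deriv (r : ℕ) (a : ℕ → ℂ) {u : ℂ → ℂ} (hu : Differentiable ℂ u) (x : ℂ) :
    airyOp r a (deriv u) x = deriv (airyOp r a u) x + u x := by
  have hd : ∀ k, HasDerivAt (iteratedDeriv k u) (iteratedDeriv k (deriv u) x) x := fun k => by
    rw [← iteratedDeriv_succ', iteratedDeriv_succ]
    exact (differentiable_iteratedDeriv_of_entire hu k x).hasDerivAt
  have h : HasDerivAt (airyOp r a u) _ x :=
    ((hd r).sub (HasDerivAt.fun_sum (u := Finset.Ico 1 (r - 1))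
    fun k _ => (hd k).const_mul (a k))).sub ((hasDerivAt_id x).mul (hu x).hasDerivAt)
  rw [h.deriv]
  simp only [airyOp, id]
  ring

theorem airyOp_comp_add_const (r : ℕ) (a : ℕ → ℂ) (u : ℂ → ℂ) (l x : ℂ) :
    airyOp r a (fun z => u (z + l)) x = airyOp r a u (x + l) + l * u (x + l) := by
  simp only [airyOp, iteratedDeriv_comp_add_const]
  ring

theorem airyOp_iterate_of_eigenfunction (r : ℕ) (a : ℕ → ℂ) (l g : ℂ) {u : ℂ → ℂ}
    (hu : Differentiable ℂ u) (hl : ∀ x, airyOp r a u x = l * u x) (i : ℕ) :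
    (airyOp r a)^[i] (fun x => g * u x + deriv u x) =
      fun x => (l ^ i * g + i * l ^ (i - 1)) * u x + l ^ i * deriv u x := by
  have hd : Differentiable ℂ (deriv u) := by
    simpa using differentiable_iteratedDeriv_of_entire hu 1
  induction i with
  | zero => simp
  | succ i ih =>
    rw [Function.iterate_succ_apply', ih, airyOp_linearCombination r a _ _ hu hd]
    funext x
    have h1 : deriv (airyOp r a u) x = l * deriv u x := by
      rw [funext hl, deriv_const_mul _ (hu x)]
    rw [airyOp_deriv r a hu, h1, hl]
    rcases i with _ | i
    · simp; ring
    · push_cast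
      ring

/-- The coefficient of `u^(k)` in `(d/dx)^j L₀^i (g·u + u')` when `L₀ u = l·u`. -/
noncomputable def eigenCoeff (r : ℕ) (a : ℕ → ℂ) (l g : ℂ) (i j k : ℕ) : Polynomial ℂ :=
  Polynomial.C (if j = k then l ^ i * g + i * l ^ (i - 1) else 0) + Polynomial.C (l ^ i) *
    (if j + 1 < r then (if j + 1 = k then 1 else 0)
      else if k = 0 then Polynomial.X + Polynomial.C l
      else if k < r - 1 then Polynomial.C (a k) else 0)

theorem iteratedDeriv_airyOp_iterate_of_eigenfunction {r : ℕ} (a : ℕ → ℂ) (l g : ℂ) {u : ℂ → ℂ}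
    (hu : Differentiable ℂ u) (hl : ∀ x, airyOp r a u x = l * u x) (i : ℕ) {j : ℕ} (hj : j < r)
    (x : ℂ) :
    iteratedDeriv j ((airyOp r a)^[i] (fun x => g * u x + deriv u x)) x =
      ∑ k : Fin r, (eigenCoeff r a l g i j k).eval x * iteratedDeriv k u x := by
  have hd : Differentiable ℂ (deriv u) := by
    simpa using differentiable_iteratedDeriv_of_entire hu 1
  rw [airyOp_iterate_of_eigenfunction r a l g hu hl, iteratedDeriv_linearCombination _ _ hu hd,
    ← iteratedDeriv_succ']
  rw [Fin.sum_univ_eq_sum_range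
    (fun k => (eigenCoeff r a l g i j k).eval x * iteratedDeriv k u x) r]
  simp only [eigenCoeff, Polynomial.eval_add, Polynomial.eval_C, Polynomial.eval_mul, add_mul,
    Finset.sum_add_distrib, ite_mul, zero_mul, Finset.sum_ite_eq, Finset.mem_range, if_pos hj]
  congr 1
  by_cases h : j + 1 < r
  · simp only [if_pos h, mul_assoc, ← Finset.mul_sum]
    simp [h, apply_ite (Polynomial.eval x), ite_mul]
  · obtain rfl : j + 1 = r := by omega
    have hx := hl x
    simp only [if_neg h, mul_assoc, ← Finset.mul_sum]
    congr 1
    rw [Finset.sum_range_succ', airyOp, sub_sub, sub_eq_iff_eq_add] at *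
    rw [hx, Finset.sum_Ico_eq_sum_range]
    simp only [Nat.succ_ne_zero, if_false, if_true, Polynomial.eval_add, Polynomial.eval_X,
      Polynomial.eval_C, iteratedDeriv_zero, Nat.add_sub_cancel]
    have : ∑ k ∈ Finset.range j,
        Polynomial.eval x (if k + 1 < j then Polynomial.C (a (k + 1)) else 0) *
          iteratedDeriv (k + 1) u x =
        ∑ k ∈ Finset.range (j - 1), a (1 + k) * iteratedDeriv (1 + k) u x := by
      symm
      rw [← Finset.sum_subset (Finset.range_mono (Nat.sub_le j 1))]
      · refine Finset.sum_congr rfl fun k hk => ?_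
        have : k + 1 < j := by simp at hk; omega
        simp [this, add_comm]
      · intro k _ hk
        have : ¬ k + 1 < j := by simp at hk; omega
        simp [this]
    rw [this]
    ring

/-- The rows of the Wronskian matrix of `r * n` functions and one further function, indexed by the
pairs `(j, i)` standing for the operator `(d/dx)^j L₀^i`, and an extra index for `L₀^n`. -/
def rowEquiv (r n : ℕ) : (Fin r × Fin n) ⊕ Fin 1 ≃ Fin (r * n + 1) :=
  (Equiv.sumCongr (((Equiv.prodComm _ _).trans finProdFinEquiv).trans (finCongr (mul_comm n r)))
    (Equiv.refl _)).trans finSumFinEquiv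

/-- The exponent of `L₀` in a row. -/
def rowPow {r n : ℕ} : (Fin r × Fin n) ⊕ Fin 1 → ℕ := Sum.elim (fun p => p.2) fun _ => n

/-- The exponent of `d/dx` in a row. -/
def rowOrd {r n : ℕ} : (Fin r × Fin n) ⊕ Fin 1 → ℕ := Sum.elim (fun p => p.1) fun _ => 0

@[simp] theorem rowOrd_inl {r n : ℕ} (p : Fin r × Fin n) :
    rowOrd (Sum.inl p : (Fin r × Fin n) ⊕ Fin 1) = p.1 := rfl

@[simp] theorem rowOrd_inr {r n : ℕ} (z : Fin 1) :
    rowOrd (Sum.inr z : (Fin r × Fin n) ⊕ Fin 1) = 0 := rfl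

theorem rowOrd_lt {r n : ℕ} (hr : 0 < r) (q : (Fin r × Fin n) ⊕ Fin 1) : rowOrd q < r := by
  rcases q with p | p
  · exact p.1.isLt
  · exact hr

theorem rowEquiv_val {r n : ℕ} (q : (Fin r × Fin n) ⊕ Fin 1) :
    (rowEquiv r n q).val = rowOrd q + r * rowPow q := by
  rcases q with p | p
  · simp [rowEquiv, rowOrd, rowPow]
  · simp [rowEquiv, rowOrd, rowPow]

theorem rowEquiv_div {r n : ℕ} (hr : 0 < r) (q : (Fin r × Fin n) ⊕ Fin 1) :
    (rowEquiv r n q).val / r = rowPow q := by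
  rw [rowEquiv_val, Nat.add_mul_div_left _ _ hr, Nat.div_eq_of_lt (rowOrd_lt hr q), zero_add]

theorem rowEquiv_mod {r n : ℕ} (hr : 0 < r) (q : (Fin r × Fin n) ⊕ Fin 1) :
    (rowEquiv r n q).val % r = rowOrd q := by
  rw [rowEquiv_val, Nat.add_mul_mod_self_left, Nat.mod_eq_of_lt (rowOrd_lt hr q)]

/-- The matrix expressing the functions `(d/dx)^j L₀^i φ_{s,t}` through the derivatives
`f_t^(k)(x + λ_s)`. -/
noncomputable def phiMatrix (r n : ℕ) (a lam gam : ℕ → ℂ) :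
    Matrix ((Fin r × Fin n) ⊕ Fin 1) (Fin r × Fin n) (Polynomial ℂ) :=
  Matrix.of fun q p => eigenCoeff r a (lam p.2) (gam p.2) (rowPow q) (rowOrd q) p.1

/-- The coefficients of the Wronskian operator in the basis `(d/dx)^j L₀^i`. -/
noncomputable def wrCoeff (r n : ℕ) (a lam gam : ℕ → ℂ) (q : (Fin r × Fin n) ⊕ Fin 1) :
    Polynomial ℂ :=
  (Matrix.fromCols (phiMatrix r n a lam gam) (Matrix.replicateCol (Fin 1) (Pi.single q 1))).det

theorem differentiable_phiFam {r n : ℕ} {f : ℕ → ℂ → ℂ} (lam gam : ℕ → ℂ) (hr : 0 < r)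
    (hf : ∀ j < r, Differentiable ℂ (f j)) (k : Fin (r * n)) :
    Differentiable ℂ (phiFam r n f lam gam k) := by
  have h := hf _ (Nat.mod_lt k.val hr)
  have hd : Differentiable ℂ (deriv (f (k.val % r))) := by
    simpa using differentiable_iteratedDeriv_of_entire h 1
  have hs : Differentiable ℂ fun x : ℂ => x + lam (k.val / r) := by fun_prop
  exact ((h.comp hs).const_mul _).add (hd.comp hs)

theorem iteratedDeriv_airyOp_iterate_phi {r n : ℕ} (a : ℕ → ℂ) {f : ℕ → ℂ → ℂ} (lam gam : ℕ → ℂ)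
    (hr : 0 < r) (hf : ∀ j < r, Differentiable ℂ (f j))
    (hker : ∀ j < r, ∀ x : ℂ, airyOp r a (f j) x = 0)
    (q : (Fin r × Fin n) ⊕ Fin 1) (p : Fin r × Fin n) (x : ℂ) :
    iteratedDeriv (rowOrd q) ((airyOp r a)^[rowPow q] (fun x =>
        gam p.2 * f p.1 (x + lam p.2) + deriv (f p.1) (x + lam p.2))) x =
      ∑ k : Fin r, (phiMatrix r n a lam gam q (k, p.2)).eval x *
        iteratedDeriv k (f p.1) (x + lam p.2) := by
  have hu : Differentiable ℂ fun x => f p.1 (x + lam p.2) :=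
    (hf _ p.1.isLt).comp (by fun_prop : Differentiable ℂ fun x : ℂ => x + lam p.2)
  have h := iteratedDeriv_airyOp_iterate_of_eigenfunction a (lam p.2) (gam p.2) hu
    (fun x => by rw [airyOp_comp_add_const, hker _ p.1.isLt, zero_add])
    (rowPow q) (rowOrd_lt hr q) x
  simpa only [iteratedDeriv_comp_add_const, deriv_comp_add_const, phiMatrix, Matrix.of_apply] using h

theorem wrDetB_phiFam {r n : ℕ} (a : ℕ → ℂ) {f : ℕ → ℂ → ℂ} (lam gam : ℕ → ℂ)
    (hr : 0 < r) (hf : ∀ j < r, Differentiable ℂ (f j))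
    (hker : ∀ j < r, ∀ x : ℂ, airyOp r a (f j) x = 0)
    (hwrf : ∀ x : ℂ, wrDet r (fun j => f j.val) x = 1)
    {u : ℂ → ℂ} (hu : Differentiable ℂ u) (x : ℂ) :
    wrDetB (r * n) (phiFam r n f lam gam) u x = ∑ q, (wrCoeff r n a lam gam q).eval x *
      iteratedDeriv (rowOrd q) ((airyOp r a)^[rowPow q] u) x := by
  have hd : ∀ s, Differentiable ℂ
      ((Fin.snoc (phiFam r n f lam gam) u : Fin (r * n + 1) → ℂ → ℂ) s) := fun s => by
    refine Fin.lastCases ?_ (fun s => ?_) s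
    · simpa using hu
    · simpa using differentiable_phiFam lam gam hr hf s
  rw [wrDetB, ← det_isDiffOp_rows (isDiffOp_iteratedDeriv_airyOp_iterate hr a) hd,
    ← Matrix.det_submatrix_equiv_self (rowEquiv r n)]
  have hM : (Matrix.of fun k s : Fin (r * n + 1) => iteratedDeriv (k.val % r)
      ((airyOp r a)^[k.val / r]
        ((Fin.snoc (phiFam r n f lam gam) u : Fin (r * n + 1) → ℂ → ℂ) s)) x).submatrix
        (rowEquiv r n) (rowEquiv r n) =
      Matrix.fromCols ((phiMatrix r n a lam gam).map (Polynomial.eval x) *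
        Matrix.blockDiagonal fun s : Fin n => Matrix.of fun k t : Fin r =>
          iteratedDeriv k.val (f t) (x + lam s))
        (Matrix.replicateCol (Fin 1) fun q =>
          iteratedDeriv (rowOrd q) ((airyOp r a)^[rowPow q] u) x) := by
    ext q (p | p)
    · have h₁ : (Fin.snoc (phiFam r n f lam gam) u : Fin (r * n + 1) → ℂ → ℂ)
          (rowEquiv r n (Sum.inl p)) = fun x =>
            gam p.2 * f p.1 (x + lam p.2) + deriv (f p.1) (x + lam p.2) := by
        have hlt : (rowEquiv r n (Sum.inl p)).val < r * n := by
          exact (finCongr (mul_comm n r) (finProdFinEquiv (p.2, p.1))).isLt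
        funext y
        simp only [Fin.snoc, hlt, dif_pos, phiFam, Fin.val_castLT, cast_eq, rowEquiv_div hr,
          rowEquiv_mod hr]
        rfl
      simp only [Matrix.submatrix_apply, Matrix.of_apply, h₁, rowEquiv_div hr, rowEquiv_mod hr,
        iteratedDeriv_airyOp_iterate_phi a lam gam hr hf hker, Matrix.fromCols_apply_inl,
        Matrix.mul_apply, Matrix.blockDiagonal_apply, Fintype.sum_prod_type, mul_ite, mul_zero,
        Finset.sum_ite_eq', Finset.mem_univ, if_true, Matrix.map_apply]
    · have h₁ : rowEquiv r n (Sum.inr p) = Fin.last _ := by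
        ext; simp [rowEquiv_val, rowOrd, rowPow]
      simp only [Matrix.submatrix_apply, Matrix.of_apply, h₁, rowEquiv_div hr, rowEquiv_mod hr,
        Fin.snoc_last, Matrix.fromCols_apply_inr, Matrix.replicateCol_apply]
  have hW : ∏ s : Fin n, (Matrix.of fun k t : Fin r =>
      iteratedDeriv k.val (f t) (x + lam s)).det = 1 :=
    Finset.prod_eq_one fun s _ => hwrf (x + lam s)
  rw [hM, Matrix.det_fromCols_mul_replicateCol, Matrix.det_blockDiagonal, hW, mul_one,
    Matrix.det_fromCols_replicateCol]
  refine Finset.sum_congr rfl fun q _ => ?_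
  rw [mul_comm, wrCoeff, ← Polynomial.coe_evalRingHom, RingHom.map_det]
  congr 2
  ext q' (p | p)
  · simp
  · by_cases h : q' = q
    · subst h; simp
    · simp [h]

theorem det_cyclic_block {r n : ℕ} (hr : 0 < r) (B D : Matrix (Fin n) (Fin n) ℂ)
    (L : Matrix (Fin r × Fin n) (Fin r × Fin n) ℂ)
    (hL : ∀ p q, L p q = if p.1.val + 1 < r then
      (if p.1.val = q.1.val then B p.2 q.2 else 0) +
        D p.2 q.2 * (if p.1.val + 1 = q.1.val then 1 else 0)
      else D p.2 q.2 * (if q.1.val = 0 then 1 else 0)) :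
    L.det = D.det ^ r ∨ L.det = -D.det ^ r := by
  obtain ⟨m, rfl⟩ : ∃ m, r = m + 1 := ⟨r - 1, by omega⟩
  let σ : Equiv.Perm (Fin (m + 1) × Fin n) :=
    Equiv.prodCongr (finRotate (m + 1)).symm (Equiv.refl _)
  have hP : (L.submatrix σ id).det = D.det ^ (m + 1) := by
    have htri : (L.submatrix σ id).BlockTriangular fun p => OrderDual.toDual p.1 := by
      rintro ⟨i, i'⟩ ⟨k, k'⟩ hik
      obtain ⟨j, rfl⟩ := (finRotate (m + 1)).surjective i
      replace hik : (finRotate (m + 1) j).val < k.val := hik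
      have hv : (finRotate (m + 1) j).val = if j = Fin.last m then 0 else j.val + 1 :=
        coe_finRotate j
      rw [hv] at hik
      have hj := j.isLt
      simp only [Matrix.submatrix_apply, id, hL, σ, Equiv.prodCongr_apply, Prod.map,
        Equiv.symm_apply_apply]
      split_ifs at hik with h
      · rw [if_neg (by simp [h]), if_neg (by omega), mul_zero]
      · have : j.val ≠ m := fun h' => h (Fin.ext h')
        rw [if_pos (by omega), if_neg (by omega), if_neg (by omega), mul_zero, zero_add]
    rw [htri.det_fintype, Finset.prod_congr rfl (g := fun _ => D.det), Finset.prod_const]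
    · simp
    rintro i -
    let e : Fin n ≃ {p : Fin (m + 1) × Fin n // OrderDual.toDual p.1 = i} :=
      { toFun := fun s => ⟨(OrderDual.ofDual i, s), rfl⟩
        invFun := fun p => p.1.2
        left_inv := fun s => rfl
        right_inv := by rintro ⟨⟨_, s⟩, rfl⟩; rfl }
    rw [← Matrix.det_submatrix_equiv_self e]
    congr 1
    ext s t
    obtain ⟨j, hj⟩ := (finRotate (m + 1)).surjective (OrderDual.ofDual i)
    have hv : (finRotate (m + 1) j).val = if j = Fin.last m then 0 else j.val + 1 :=
      coe_finRotate j
    have hjlt := j.isLt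
    simp only [Matrix.submatrix_apply, Matrix.toSquareBlock_def, Matrix.of_apply, hL, e, σ, id,
      Equiv.prodCongr_apply, Prod.map, Equiv.coe_fn_mk, ← hj, Equiv.symm_apply_apply,
      Equiv.refl_apply]
    split_ifs at hv with h
    · rw [if_neg (by simp [h]), if_pos hv, mul_one]
    · have : j.val ≠ m := fun h' => h (Fin.ext h')
      rw [if_pos (by omega), if_neg (by omega), if_pos hv.symm, mul_one, zero_add]
  rw [Matrix.det_permute] at hP
  rcases Int.units_eq_one_or (Equiv.Perm.sign σ) with h | h
  · exact Or.inl (by simpa [h] using hP)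
  · exact Or.inr (by rw [← hP]; simp [h])

theorem vand_eq_or_neg (n : ℕ) (lam : ℕ → ℂ) :
    (Matrix.vandermonde fun s : Fin n => lam s).det = vand n lam ∨
      (Matrix.vandermonde fun s : Fin n => lam s).det = -vand n lam := by
  have h : vand n lam = ∏ i : Fin n, ∏ j ∈ Finset.Ioi i, (lam i - lam j) := by
    rw [vand, Finset.prod_range]
    refine Finset.prod_congr rfl fun i _ => ?_
    refine Eq.trans ?_ (Finset.prod_map (Finset.Ioi i) Fin.valEmbedding fun j => lam i - lam j)
    rw [Fin.map_valEmbedding_Ioi]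
    refine Finset.prod_congr ?_ fun _ _ => rfl
    ext j
    simp
  have h' : (Matrix.vandermonde fun s : Fin n => lam s).det =
      (∏ i : Fin n, ∏ j ∈ Finset.Ioi i, (-1)) * vand n lam := by
    simp only [h, Matrix.det_vandermonde, ← Finset.prod_mul_distrib]
    simp
  rw [h']
  simp only [Finset.prod_const, Finset.prod_pow_eq_pow_sum]
  rcases neg_one_pow_eq_or ℂ (∑ i : Fin n, (Finset.Ioi i).card) with h | h <;> rw [h] <;> simp

theorem vand_ne_zero {n : ℕ} {lam : ℕ → ℂ}
    (hlam : ∀ i < n, ∀ j < n, i ≠ j → lam i ≠ lam j) : vand n lam ≠ 0 := by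
  refine Finset.prod_ne_zero_iff.2 fun i hi => Finset.prod_ne_zero_iff.2 fun j hj => ?_
  simp only [Finset.mem_range, Finset.mem_Ico] at hi hj
  exact sub_ne_zero.2 (hlam i hi j hj.2 (by omega))

theorem exists_sum_mul_pow_eq {n : ℕ} {lam : ℕ → ℂ}
    (hlam : ∀ i < n, ∀ j < n, i ≠ j → lam i ≠ lam j) (b : Fin n → ℂ) :
    ∃ c : Fin n → ℂ, ∀ s : Fin n, ∑ i : Fin n, c i * lam s ^ i.val = b s := by
  have hdet : (Matrix.vandermonde fun s : Fin n => lam s).det ≠ 0 :=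
    Matrix.det_vandermonde_ne_zero_iff.2 fun s t hst => by
      by_contra hne
      exact hlam s s.isLt t t.isLt (fun h => hne (Fin.ext h)) hst
  obtain ⟨c, hc⟩ := Matrix.mulVec_surjective_iff_isUnit.2
    ((Matrix.isUnit_iff_isUnit_det _).2 hdet.isUnit) b
  refine ⟨c, fun s => ?_⟩
  rw [← hc]
  simp [Matrix.mulVec, dotProduct, Matrix.vandermonde_apply, mul_comm]

/-- The coefficient of `eigenCoeff` in degree `0` or, for the highest derivative, degree `1`. -/
noncomputable def eigenLead (r : ℕ) (l g : ℂ) (i j k : ℕ) : ℂ :=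
  if j + 1 < r then
    (if j = k then l ^ i * g + i * l ^ (i - 1) else 0) + l ^ i * (if j + 1 = k then 1 else 0)
  else l ^ i * (if k = 0 then 1 else 0)

theorem natDegree_eigenCoeff_le (r : ℕ) (a : ℕ → ℂ) (l g : ℂ) (i j k : ℕ) :
    (eigenCoeff r a l g i j k).natDegree ≤ if j + 1 < r then 0 else 1 := by
  unfold eigenCoeff
  split_ifs <;> compute_degree <;> omega

theorem coeff_eigenCoeff (r : ℕ) (a : ℕ → ℂ) (l g : ℂ) (i j k : ℕ) :
    (eigenCoeff r a l g i j k).coeff (if j + 1 < r then 0 else 1) = eigenLead r l g i j k := by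
  unfold eigenCoeff eigenLead
  by_cases h : j + 1 < r
  · simp only [if_pos h, Polynomial.coeff_add, Polynomial.coeff_C_mul, Polynomial.coeff_C_zero]
    split_ifs <;> simp
  · simp only [if_neg h, Polynomial.coeff_add, Polynomial.coeff_C_mul]
    rw [Polynomial.coeff_C_of_ne_zero one_ne_zero, zero_add]
    split_ifs <;> simp

theorem sum_rowDegree {r : ℕ} (hr : 2 ≤ r) (n : ℕ) :
    ∑ q : (Fin r × Fin n) ⊕ Fin 1, (if rowOrd q + 1 < r then 0 else 1) = n := by
  have hr' : 1 < r := hr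
  rw [Fintype.sum_sum_type, Fintype.sum_prod_type]
  change ∑ j : Fin r, ∑ _s : Fin n, (if j.val + 1 < r then 0 else 1) +
    ∑ _z : Fin 1, (if 0 + 1 < r then 0 else 1) = n
  simp only [Finset.sum_const, Finset.card_univ, Fintype.card_fin, zero_add, if_pos hr',
    mul_zero, add_zero, smul_eq_mul]
  rw [Finset.sum_eq_single (⟨r - 1, by omega⟩ : Fin r)]
  · rw [if_neg (by simp only; omega), mul_one]
  · intro j _ hj
    have : j.val ≠ r - 1 := fun h => hj (Fin.ext h)
    have := j.isLt
    rw [if_pos (by omega), mul_zero]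
  · simp

/-- The leading part of `phiMatrix`. -/
noncomputable def phiLead (r n : ℕ) (lam gam : ℕ → ℂ) :
    Matrix ((Fin r × Fin n) ⊕ Fin 1) (Fin r × Fin n) ℂ :=
  Matrix.of fun q p => eigenLead r (lam p.2) (gam p.2) (rowPow q) (rowOrd q) p.1

theorem natDegree_wrCoeff_aux {r n : ℕ} (a lam gam : ℕ → ℂ) (q₀ q : (Fin r × Fin n) ⊕ Fin 1)
    (p : (Fin r × Fin n) ⊕ Fin 1) :
    (Matrix.fromCols (phiMatrix r n a lam gam)
      (Matrix.replicateCol (Fin 1) (Pi.single q₀ 1)) q p).natDegree ≤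
        if rowOrd q + 1 < r then 0 else 1 := by
  rcases p with p | p
  · exact natDegree_eigenCoeff_le _ _ _ _ _ _ _
  · by_cases h : q = q₀
    · subst h; simp
    · simp [h]

theorem natDegree_wrCoeff_le {r n : ℕ} (hr : 2 ≤ r) (a lam gam : ℕ → ℂ)
    (q : (Fin r × Fin n) ⊕ Fin 1) : (wrCoeff r n a lam gam q).natDegree ≤ n :=
  (Matrix.natDegree_det_le_sum (natDegree_wrCoeff_aux a lam gam q)).trans (sum_rowDegree hr n).le

theorem coeff_wrCoeff {r n : ℕ} (hr : 2 ≤ r) (a lam gam : ℕ → ℂ)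
    (q₀ : (Fin r × Fin n) ⊕ Fin 1) :
    (wrCoeff r n a lam gam q₀).coeff n = (Matrix.fromCols (phiLead r n lam gam)
      (Matrix.replicateCol (Fin 1)
        (Pi.single q₀ (if rowOrd q₀ + 1 < r then 1 else 0)))).det := by
  have h := Matrix.coeff_det_sum (natDegree_wrCoeff_aux a lam gam q₀)
  rw [sum_rowDegree hr n] at h
  rw [wrCoeff, h]
  congr 1
  ext q (p | p)
  · exact coeff_eigenCoeff _ _ _ _ _ _ _
  · by_cases h : q = q₀
    · subst h
      simp [Polynomial.coeff_one]
    · simp [h]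

theorem coeff_wrCoeff_eq_zero {r n : ℕ} (hr : 2 ≤ r) (a : ℕ → ℂ) {lam : ℕ → ℂ} (gam : ℕ → ℂ)
    (hlam : ∀ i < n, ∀ j < n, i ≠ j → lam i ≠ lam j)
    {q₀ : (Fin r × Fin n) ⊕ Fin 1} (hq₀ : rowOrd q₀ ≠ 0) :
    (wrCoeff r n a lam gam q₀).coeff n = 0 := by
  rw [coeff_wrCoeff hr, ← Matrix.exists_vecMul_eq_zero_iff]
  obtain ⟨c, hc⟩ := exists_sum_mul_pow_eq hlam fun s : Fin n => -lam s ^ n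
  obtain ⟨w, hw⟩ := exists_sum_mul_pow_eq hlam fun s : Fin n =>
    -(∑ i : Fin n, c i * (lam s ^ i.val * gam s + i.val * lam s ^ (i.val - 1)) +
      (lam s ^ n * gam s + n * lam s ^ (n - 1)))
  let v : (Fin r × Fin n) ⊕ Fin 1 → ℂ := Sum.elim (fun p =>
    if p.1.val = 0 then c p.2 else if p.1.val + 1 < r then 0 else w p.2) 1
  refine ⟨v, fun hv => by simpa [v] using congrFun hv (Sum.inr 0), ?_⟩
  ext (p | p)
  · obtain ⟨k, s⟩ := p
    have hr' : 1 < r := hr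
    simp only [Matrix.vecMul, dotProduct, Matrix.fromCols_apply_inl, Fintype.sum_sum_type,
      Fintype.sum_prod_type, phiLead, Matrix.of_apply, rowPow, rowOrd, Sum.elim_inl, Sum.elim_inr,
      v, Finset.univ_unique, Finset.sum_singleton, Pi.one_apply, one_mul, Pi.zero_apply]
    rw [Fintype.sum_eq_add (⟨0, by omega⟩ : Fin r) ⟨r - 1, by omega⟩
      (by simp [Fin.ext_iff]; omega) fun j hj => ?_]
    · have h₁ : ¬ (r - 1 + 1 < r) := by omega
      have h₂ : r - 1 ≠ 0 := by omega
      simp only [if_true, if_neg h₂, if_neg h₁, eigenLead, zero_add, if_pos hr']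
      rcases Nat.lt_trichotomy k.val 1 with hk | hk | hk
      · have hk0 : k.val = 0 := by omega
        simp only [hk0, if_true, one_ne_zero, if_false, mul_zero, add_zero, mul_one, hw]
        ring
      · simp only [hk, zero_ne_one, one_ne_zero, if_true, if_false, mul_zero, zero_add, mul_one,
          Finset.sum_const_zero, add_zero, hc]
        ring
      · simp [show k.val ≠ 0 by omega, show (0 : ℕ) ≠ k.val by omega,
          show (1 : ℕ) ≠ k.val by omega]
    · have h₀ : j.val ≠ 0 := fun h => hj.1 (Fin.ext h)
      have h₁ : j.val ≠ r - 1 := fun h => hj.2 (Fin.ext h)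
      have h₂ : j.val + 1 < r := by have := j.isLt; omega
      simp [h₀, h₂]
  · simp only [Matrix.vecMul, dotProduct, Matrix.fromCols_apply_inr, Matrix.replicateCol_apply,
      Pi.single_apply, mul_ite, mul_zero, mul_one, Finset.sum_ite_eq', Finset.mem_univ, if_true,
      Pi.zero_apply]
    rcases q₀ with q₀ | q₀
    · have : q₀.1.val ≠ 0 := hq₀
      simp only [v, rowOrd, Sum.elim_inl, if_neg this]
      split_ifs <;> rfl
    · exact absurd rfl hq₀

theorem coeff_wrCoeff_inr {r n : ℕ} (hr : 2 ≤ r) (a lam gam : ℕ → ℂ) (z : Fin 1) :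
    (wrCoeff r n a lam gam (Sum.inr z)).coeff n = vand n lam ^ r ∨
      (wrCoeff r n a lam gam (Sum.inr z)).coeff n = -(vand n lam ^ r) := by
  have hz : Matrix.fromCols (phiLead r n lam gam) (Matrix.replicateCol (Fin 1)
      (Pi.single (Sum.inr z) (1 : ℂ))) = Matrix.fromBlocks (phiLead r n lam gam).toRows₁ 0
        (phiLead r n lam gam).toRows₂ 1 := by
    ext (q | q) (p | p)
    · rfl
    · simp
    · rfl
    · simp [Subsingleton.elim q p, Subsingleton.elim z p]
  have hr' : rowOrd (Sum.inr z : (Fin r × Fin n) ⊕ Fin 1) + 1 < r := hr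
  rw [coeff_wrCoeff hr, if_pos hr', hz, Matrix.det_fromBlocks_zero₁₂, Matrix.det_one, mul_one]
  have hdet := det_cyclic_block (r := r) (by omega)
    (Matrix.of fun i s : Fin n => lam s ^ i.val * gam s + i.val * lam s ^ (i.val - 1))
    (Matrix.vandermonde fun s : Fin n => lam s).transpose (phiLead r n lam gam).toRows₁
    fun p q => rfl
  rw [Matrix.det_transpose] at hdet
  rcases vand_eq_or_neg n lam with h | h
  · rwa [h] at hdet
  · rw [h, neg_pow] at hdet
    rcases neg_one_pow_eq_or ℂ r with hs | hs
    · simpa [hs] using hdet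
    · simpa [hs, or_comm] using hdet

/-- The coefficients `K_{i,j}` of the Wronskian operator. -/
noncomputable def wrFamily (r n : ℕ) (a lam gam : ℕ → ℂ) (i j : ℕ) : Polynomial ℂ :=
  if h : (i, j) ∈ idxSet r n then
    wrCoeff r n a lam gam
      ((rowEquiv r n).symm ⟨i * r + j, Nat.lt_succ_of_le (mem_idxSet.1 h).2.2⟩)
  else 0

theorem wrFamily_of_notMem {r n i j : ℕ} (a lam gam : ℕ → ℂ) (h : (i, j) ∉ idxSet r n) :
    wrFamily r n a lam gam i j = 0 := dif_neg h

theorem wrFamily_rowPow_rowOrd {r n : ℕ} (hr : 0 < r) (a lam gam : ℕ → ℂ)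
    (q : (Fin r × Fin n) ⊕ Fin 1) :
    wrFamily r n a lam gam (rowPow q) (rowOrd q) = wrCoeff r n a lam gam q := by
  have h := div_mod_mem_idxSet hr (rowEquiv r n q)
  rw [rowEquiv_div hr, rowEquiv_mod hr] at h
  rw [wrFamily, dif_pos h]
  congr 1
  rw [Equiv.symm_apply_eq]
  ext
  rw [rowEquiv_val]
  ring

theorem exists_row_of_mem_idxSet {r n i j : ℕ} (h : (i, j) ∈ idxSet r n) :
    ∃ q : (Fin r × Fin n) ⊕ Fin 1, rowPow q = i ∧ rowOrd q = j := by
  obtain ⟨-, hj, hij⟩ := mem_idxSet.1 h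
  have hr : 0 < r := by omega
  refine ⟨(rowEquiv r n).symm ⟨i * r + j, Nat.lt_succ_of_le hij⟩, ?_, ?_⟩
  · rw [← rowEquiv_div hr, Equiv.apply_symm_apply]
    simp [mul_comm i r, Nat.mul_add_div hr, Nat.div_eq_of_lt hj]
  · rw [← rowEquiv_mod hr, Equiv.apply_symm_apply]
    simp [mul_comm i r, Nat.mod_eq_of_lt hj]

theorem expProp_wrFamily {r n : ℕ} (a : ℕ → ℂ) {f : ℕ → ℂ → ℂ} (lam gam : ℕ → ℂ)
    (hr : 0 < r) (hf : ∀ j < r, Differentiable ℂ (f j))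
    (hker : ∀ j < r, ∀ x : ℂ, airyOp r a (f j) x = 0)
    (hwrf : ∀ x : ℂ, wrDet r (fun j => f j.val) x = 1) :
    ExpProp r n a (phiFam r n f lam gam) (wrFamily r n a lam gam) := by
  refine ⟨fun i j h => wrFamily_of_notMem a lam gam h, fun u hu x => ?_⟩
  rw [wrDetB_phiFam a lam gam hr hf hker hwrf hu, sum_idxSet hr fun i j =>
    (wrFamily r n a lam gam i j).eval x * iteratedDeriv j ((airyOp r a)^[i] u) x,
    ← (rowEquiv r n).sum_comp]
  simp only [rowEquiv_div hr, rowEquiv_mod hr, wrFamily_rowPow_rowOrd hr]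

theorem ExpProp.unique {r n : ℕ} (hr : 0 < r) {a : ℕ → ℂ} {φ : Fin (r * n) → ℂ → ℂ}
    {K K' : ℕ → ℕ → Polynomial ℂ} (h : ExpProp r n a φ K) (h' : ExpProp r n a φ K') :
    K = K' := by
  funext i j
  by_cases hij : (i, j) ∈ idxSet r n
  swap
  · rw [h.1 i j hij, h'.1 i j hij]
  refine Polynomial.funext fun x => ?_
  have hκ := eq_zero_of_sum_isDiffOp_eq_zero (isDiffOp_iteratedDeriv_airyOp_iterate hr a)
    (m := r * n + 1) (x := x)
    (κ := fun k => (K (k.val / r) (k.val % r)).eval x - (K' (k.val / r) (k.val % r)).eval x)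
    fun u hu => by
      have hu' := (h.2 u hu x).symm.trans (h'.2 u hu x)
      rw [sum_idxSet hr fun i j => (K i j).eval x * iteratedDeriv j ((airyOp r a)^[i] u) x,
        sum_idxSet hr fun i j => (K' i j).eval x * iteratedDeriv j ((airyOp r a)^[i] u) x] at hu'
      simp only [sub_mul, Finset.sum_sub_distrib, hu', sub_self]
  obtain ⟨q, rfl, rfl⟩ := exists_row_of_mem_idxSet hij
  have := congrFun hκ (rowEquiv r n q)
  simp only [rowEquiv_div hr, rowEquiv_mod hr] at this
  exact sub_eq_zero.1 this

theorem natDegree_wrFamily_le {r n : ℕ} (hr : 2 ≤ r) (a lam gam : ℕ → ℂ) (i j : ℕ) :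
    (wrFamily r n a lam gam i j).natDegree ≤ n := by
  by_cases h : (i, j) ∈ idxSet r n
  · obtain ⟨q, rfl, rfl⟩ := exists_row_of_mem_idxSet h
    rw [wrFamily_rowPow_rowOrd (by omega)]
    exact natDegree_wrCoeff_le hr a lam gam q
  · simp [wrFamily_of_notMem a lam gam h]

theorem degree_wrFamily_lt {r n : ℕ} (hr : 2 ≤ r) (a : ℕ → ℂ) {lam : ℕ → ℂ} (gam : ℕ → ℂ)
    (hlam : ∀ i < n, ∀ j < n, i ≠ j → lam i ≠ lam j) (i : ℕ) {j : ℕ} (hj : 1 ≤ j) :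
    (wrFamily r n a lam gam i j).degree < n := by
  have hcoeff : (wrFamily r n a lam gam i j).coeff n = 0 := by
    by_cases h : (i, j) ∈ idxSet r n
    · obtain ⟨q, rfl, rfl⟩ := exists_row_of_mem_idxSet h
      rw [wrFamily_rowPow_rowOrd (by omega)]
      exact coeff_wrCoeff_eq_zero hr a gam hlam (by omega)
    · simp [wrFamily_of_notMem a lam gam h]
  refine (Polynomial.degree_lt_iff_coeff_zero _ _).2 fun m hm => ?_
  rcases hm.eq_or_lt with rfl | hm
  · exact hcoeff
  · exact Polynomial.coeff_eq_zero_of_natDegree_lt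
      ((natDegree_wrFamily_le hr a lam gam i j).trans_lt hm)

theorem coeff_wrFamily_zero {r n : ℕ} (hr : 2 ≤ r) (a lam gam : ℕ → ℂ) :
    (wrFamily r n a lam gam n 0).coeff n = vand n lam ^ r ∨
      (wrFamily r n a lam gam n 0).coeff n = -(vand n lam ^ r) := by
  have h := wrFamily_rowPow_rowOrd (n := n) (by omega : 0 < r) a lam gam (Sum.inr 0)
  have h' : wrFamily r n a lam gam n 0 = wrCoeff r n a lam gam (Sum.inr 0) := h
  rw [h']
  exact coeff_wrCoeff_inr hr a lam gam 0

theorem statement3 (r n : ℕ) (a : ℕ → ℂ) (f : ℕ → ℂ → ℂ) (lam gam : ℕ → ℂ)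
    (hr : 2 ≤ r) (hn : 1 ≤ n)
    (hf : ∀ j < r, Differentiable ℂ (f j))
    (hker : ∀ j < r, ∀ x : ℂ, airyOp r a (f j) x = 0)
    (hwrf : ∀ x : ℂ, wrDet r (fun j => f j.val) x = 1)
    (hlam : ∀ i < n, ∀ j < n, i ≠ j → lam i ≠ lam j) :
    (∃! K : ℕ → ℕ → Polynomial ℂ, ExpProp r n a (phiFam r n f lam gam) K) ∧
    ∀ K : ℕ → ℕ → Polynomial ℂ, ExpProp r n a (phiFam r n f lam gam) K →
      (∀ i : ℕ, (K i 0).degree ≤ (n : WithBot ℕ)) ∧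
      (∀ i j : ℕ, 1 ≤ j → (K i j).degree < (n : WithBot ℕ)) ∧
      (K n 0).degree = (n : WithBot ℕ) ∧
      ((K n 0).leadingCoeff = vand n lam ^ r ∨ (K n 0).leadingCoeff = -(vand n lam ^ r)) ∧
      ∃ C : ℕ → Polynomial ℂ, C (r * n) ≠ 0 ∧
        ∀ u : ℂ → ℂ, Differentiable ℂ u → ∀ x : ℂ,
          Fop r n a K u x
            = ∑ k ∈ Finset.range (r * n + 1), (C k).eval x * iteratedDeriv k u x := by
  have hr0 : 0 < r := by omega
  have hK₀ := expProp_wrFamily (n := n) a lam gam hr0 hf hker hwrf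
  refine ⟨⟨_, hK₀, fun K hK => hK.unique hr0 hK₀⟩, fun K hK => ?_⟩
  obtain rfl := hK.unique hr0 hK₀
  have hle := natDegree_wrFamily_le (n := n) hr a lam gam
  have hlt : ∀ i j : ℕ, 1 ≤ j → (wrFamily r n a lam gam i j).degree < (n : WithBot ℕ) :=
    fun i j hj => degree_wrFamily_lt hr a gam hlam i hj
  have hcoeff := coeff_wrFamily_zero (n := n) hr a lam gam
  have hne : (wrFamily r n a lam gam n 0).coeff n ≠ 0 := by
    have hV := pow_ne_zero r (vand_ne_zero hlam)
    rcases hcoeff with h | h <;> rw [h]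
    · exact hV
    · exact neg_ne_zero.2 hV
  have hdeg : (wrFamily r n a lam gam n 0).degree = (n : WithBot ℕ) :=
    Polynomial.degree_eq_of_le_of_coeff_ne_zero
      (Polynomial.natDegree_le_iff_degree_le.1 (hle n 0)) hne
  refine ⟨fun i => Polynomial.natDegree_le_iff_degree_le.1 (hle i 0), hlt, hdeg, ?_, ?_⟩
  · rwa [Polynomial.leadingCoeff, Polynomial.natDegree_eq_of_degree_eq_some hdeg]
  · obtain ⟨c, hc, C, rfl, hC⟩ := isDiffOp_Fop hr0 a (fun i => hle i 0) hlt
    exact ⟨C, fun h => hne (by rw [← hc, h, Polynomial.coeff_zero]), hC⟩
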